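/- Let G = (S ∪ 𝒯, E) be a finite multigraph whose terminals 𝒯 are degree-one vertices adjacent to S, with |𝒯| = k ≥ 3 and G[S] connected. Then S can be partitioned into at most k − 2 sets, each of which is connectivity-2 linked in G. -/

import Mathlib

/-- A multigraph on vertex type `V` with edge type `E`: each edge has an
unordered pair of endpoints (possibly equal, i.e. a loop). -/
structure Multigraph (V : Type) (E : Type) where
  ends : E → Sym2 V

namespace Multigraph

variable {V E : Type}

/-- Reachability in `G` after removing the edge set `F`: there is a walk from
`a` to `b` using only edges not in `F`. -/
def Reach (G : Multigraph V E) (F : Set E) (a b : V) : Prop :=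
  Relation.ReflTransGen (fun x y => ∃ e, e ∉ F ∧ G.ends e = s(x, y)) a b

/-- The edge set `F` separates `A` from `B` in `G`. -/
def Separates (G : Multigraph V E) (F : Set E) (A B : Set V) : Prop :=
  ∀ a ∈ A, ∀ b ∈ B, ¬ G.Reach F a b

/-- The minimum number of edges whose removal leaves no path from `A` to `B`
(`0` if `A` or `B` is empty). -/
noncomputable def mincut (G : Multigraph V E) (A B : Set V) : ℕ :=
  sInf {n | ∃ F : Finset E, G.Separates ↑F A B ∧ F.card = n}

/-- The thresholded minimum cut `min(mincut, c)`. -/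
noncomputable def mincutC (G : Multigraph V E) (c : ℕ) (A B : Set V) : ℕ :=
  min (G.mincut A B) c

/-- `E_G(A,B)`: the edges with one endpoint in `A` and the other in `B`. -/
def edgesBetween (G : Multigraph V E) (A B : Set V) : Set E :=
  {e | ∃ a ∈ A, ∃ b ∈ B, G.ends e = s(a, b)}

/-- `∂(X)`: the boundary edges of `X`. -/
def bdry (G : Multigraph V E) (X : Set V) : Set E :=
  G.edgesBetween X Xᶜ

/-- The edges of the induced subgraph `G[X]` (both endpoints in `X`). -/
def edgesIn (G : Multigraph V E) (X : Set V) : Set E :=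
  {e | ∀ v ∈ G.ends e, v ∈ X}

/-- Reachability inside the induced subgraph `G[U]`, avoiding removed edges `F`. -/
def ReachIn (G : Multigraph V E) (U : Set V) (F : Set E) (a b : V) : Prop :=
  Relation.ReflTransGen
    (fun x y => x ∈ U ∧ y ∈ U ∧ ∃ e, e ∉ F ∧ G.ends e = s(x, y)) a b

/-- `G = (S ∪ 𝒯, E)`: the vertex set is partitioned into `S` and the terminal
set `T`, and each terminal is a degree-one vertex adjacent to a vertex of `S`. -/
def TerminalSetup (G : Multigraph V E) (S T : Set V) : Prop :=
  Disjoint S T ∧ S ∪ T = Set.univ ∧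
    ∀ t ∈ T, ∃ e, ∃ u ∈ S, G.ends e = s(t, u) ∧ ∀ e', t ∈ G.ends e' → e' = e

/-- `X` is connectivity-`c` linked in `G`: for every partition of `X` into
disjoint sets `A` and `B`,
`|E_G(A,B)| ≥ min(|∂(A) ∩ ∂(X)|, |∂(B) ∩ ∂(X)|, c)`. -/
def Linked (G : Multigraph V E) (c : ℕ) (X : Set V) : Prop :=
  ∀ A B : Set V, Disjoint A B → A ∪ B = X →
    min (min ((G.bdry A ∩ G.bdry X).ncard) ((G.bdry B ∩ G.bdry X).ncard)) c ≤
      (G.edgesBetween A B).ncard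

end Multigraph

namespace Multigraph

variable {V E : Type}

theorem edgesBetween_comm (G : Multigraph V E) (A B : Set V) :
    G.edgesBetween A B = G.edgesBetween B A := by
  ext e
  constructor <;> rintro ⟨a, ha, b, hb, h⟩ <;> exact ⟨b, hb, a, ha, h.trans Sym2.eq_swap⟩

/-- `X` induces a connected subgraph: every partition of `X` into two nonempty parts is crossed
by an edge. -/
def CutConnected (G : Multigraph V E) (X : Set V) : Prop :=
  ∀ A B : Set V, Disjoint A B → A ∪ B = X → A.Nonempty → B.Nonempty →
    (G.edgesBetween A B).Nonempty

theorem cutConnected_of_reachIn {G : Multigraph V E} {X : Set V}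
    (h : ∀ a ∈ X, ∀ b ∈ X, G.ReachIn X ∅ a b) : G.CutConnected X := by
  rintro A B hd rfl ⟨a, ha⟩ ⟨b, hb⟩
  by_contra hne
  have stay : ∀ x, G.ReachIn (A ∪ B) ∅ a x → x ∈ A := by
    intro x hx
    induction hx with
    | refl => exact ha
    | tail _ hs ih =>
      obtain ⟨_, hy | hy, e, _, he⟩ := hs
      · exact hy
      · exact absurd ⟨e, _, ih, _, hy, he⟩ hne
  exact Set.disjoint_left.1 hd (stay b (h a (.inl ha) b (.inr hb))) hb

/-- If only one edge joins the two parts of a connected set, each part is connected. -/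
theorem CutConnected.left [Finite E] {G : Multigraph V E} {A B : Set V}
    (h : G.CutConnected (A ∪ B)) (hd : Disjoint A B) (hB : B.Nonempty)
    (hc : (G.edgesBetween A B).ncard ≤ 1) : G.CutConnected A := by
  rintro A₁ A₂ hd' rfl h₁ h₂
  by_contra hne
  rw [Set.disjoint_left] at hd hd'
  obtain ⟨e, x, hx, y, hy, he⟩ := h A₁ (A₂ ∪ B)
    (Set.disjoint_left.2 (by grind)) (by grind) h₁ (.inr hB)
  obtain ⟨f, u, hu, v, hv, hf⟩ := h A₂ (A₁ ∪ B)
    (Set.disjoint_left.2 (by grind)) (by grind) h₂ (.inr hB)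
  have hyB : y ∈ B := hy.resolve_left fun hy => hne ⟨e, x, hx, y, hy, he⟩
  have hvB : v ∈ B := hv.resolve_left fun hv =>
    hne ⟨f, v, hv, u, hu, hf.trans Sym2.eq_swap⟩
  have hef : e = f := (Set.ncard_le_one (Set.toFinite _)).1 hc e ⟨x, .inl hx, y, hyB, he⟩
    f ⟨u, .inr hu, v, hvB, hf⟩
  subst hef
  rw [he, Sym2.eq_iff] at hf
  grind

theorem ncard_bdry_left [Finite E] (G : Multigraph V E) {A B : Set V} (hd : Disjoint A B) :
    (G.bdry A).ncard =
      (G.bdry A ∩ G.bdry (A ∪ B)).ncard + (G.edgesBetween A B).ncard := by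
  rw [Set.disjoint_left] at hd
  rw [← Set.ncard_union_eq]
  · congr 1
    ext e
    constructor
    · rintro ⟨a, ha, x, hx, he⟩
      by_cases hxB : x ∈ B
      · exact .inr ⟨a, ha, x, hxB, he⟩
      · exact .inl ⟨⟨a, ha, x, hx, he⟩, a, .inl ha, x, by grind, he⟩
    · rintro (h | ⟨a, ha, b, hb, he⟩)
      · exact h.1
      · exact ⟨a, ha, b, fun h => hd h hb, he⟩
  · rw [Set.disjoint_left]
    rintro e ⟨_, x, hx, y, hy, he⟩ ⟨a, ha, b, hb, he'⟩
    rw [he, Sym2.eq_iff] at he'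
    grind

theorem ncard_bdry_union [Finite E] (G : Multigraph V E) {A B : Set V} (hd : Disjoint A B) :
    (G.bdry (A ∪ B)).ncard =
      (G.bdry A ∩ G.bdry (A ∪ B)).ncard + (G.bdry B ∩ G.bdry (A ∪ B)).ncard := by
  rw [Set.disjoint_left] at hd
  rw [← Set.ncard_union_eq]
  · congr 1
    ext e
    constructor
    · intro h
      obtain ⟨a, ha | ha, x, hx, he⟩ := id h
      · exact .inl ⟨⟨a, ha, x, by grind, he⟩, h⟩
      · exact .inr ⟨⟨a, ha, x, by grind, he⟩, h⟩
    · rintro (h | h) <;> exact h.2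
  · rw [Set.disjoint_left]
    rintro e ⟨⟨x, hx, y, hy, he⟩, u, hu, v, hv, he'⟩ ⟨⟨a, ha, b, hb, he''⟩, _⟩
    rw [he, Sym2.eq_iff] at he' he''
    grind

theorem nonempty_of_bdry_ncard_pos {G : Multigraph V E} {X : Set V} {F : Set E}
    (h : 0 < (G.bdry X ∩ F).ncard) : X.Nonempty := by
  obtain ⟨e, ⟨x, hx, _⟩, _⟩ := Set.nonempty_of_ncard_ne_zero h.ne'
  exact ⟨x, hx⟩

/-- A connected set with at least three boundary edges splits into at most `|∂(X)| - 2` parts that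
are connectivity-2 linked. -/
theorem CutConnected.exists_linked_partition [Finite E] {G : Multigraph V E} {X : Set V}
    (hX : G.CutConnected X) (h3 : 3 ≤ (G.bdry X).ncard) :
    ∃ P : Finset (Set V), P.card ≤ (G.bdry X).ncard - 2 ∧
      (∀ Y ∈ P, Y.Nonempty ∧ G.Linked 2 Y) ∧
      (P : Set (Set V)).PairwiseDisjoint id ∧ ⋃₀ (P : Set (Set V)) = X := by
  classical
  induction hn : (G.bdry X).ncard using Nat.strong_induction_on generalizing X with
  | _ n ih =>
  subst hn
  by_cases hL : G.Linked 2 X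
  · refine ⟨{X}, by rw [Finset.card_singleton]; omega, ?_, by simp, by simp⟩
    simp only [Finset.mem_singleton, forall_eq]
    refine ⟨nonempty_of_bdry_ncard_pos (G := G) (F := Set.univ) ?_, hL⟩
    rw [Set.inter_univ]
    omega
  · simp only [Linked, not_forall, not_le] at hL
    obtain ⟨A, B, hd, rfl, hlt⟩ := hL
    have hcA := G.ncard_bdry_left hd
    have hcB := G.ncard_bdry_left hd.symm
    rw [Set.union_comm B A, G.edgesBetween_comm B A] at hcB
    have hcX := G.ncard_bdry_union hd
    have hA : A.Nonempty := nonempty_of_bdry_ncard_pos (G := G) (F := G.bdry (A ∪ B)) (by omega)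
    have hB : B.Nonempty := nonempty_of_bdry_ncard_pos (G := G) (F := G.bdry (A ∪ B)) (by omega)
    have hpos := (Set.ncard_pos (Set.toFinite _)).2 (hX A B hd rfl hA hB)
    have hXA := hX.left hd hB (by omega)
    have hXB : G.CutConnected B := by
      rw [Set.union_comm] at hX
      exact hX.left hd.symm hA (by rw [edgesBetween_comm]; omega)
    obtain ⟨P, hP, hPl, hPd, rfl⟩ := ih _ (by omega) hXA (by omega) rfl
    obtain ⟨Q, hQ, hQl, hQd, rfl⟩ := ih _ (by omega) hXB (by omega) rfl
    refine ⟨P ∪ Q, (Finset.card_union_le P Q).trans (by omega), ?_, ?_, ?_⟩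
    · intro Y hY
      exact (Finset.mem_union.1 hY).elim (hPl Y) (hQl Y)
    · rw [Finset.coe_union]
      refine Set.pairwiseDisjoint_union.2 ⟨hPd, hQd, fun Y hY Z hZ _ => ?_⟩
      exact hd.mono (Set.subset_sUnion_of_mem hY) (Set.subset_sUnion_of_mem hZ)
    · rw [Finset.coe_union, Set.sUnion_union]

theorem TerminalSetup.ncard_bdry {G : Multigraph V E} {S T : Set V} (h : G.TerminalSetup S T) :
    (G.bdry S).ncard = T.ncard := by
  obtain ⟨hd, hu, ht⟩ := h
  rw [Set.disjoint_left] at hd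
  choose f u hf using ht
  refine (Set.ncard_congr f ?_ ?_ ?_).symm
  · intro t ht
    exact ⟨u t ht, (hf t ht).1, t, fun h => hd h ht, (hf t ht).2.1.trans Sym2.eq_swap⟩
  · intro s t hs ht hst
    have h₁ := (hf s hs).2.1
    rw [hst, (hf t ht).2.1, Sym2.eq_iff] at h₁
    rcases h₁ with ⟨h₁, _⟩ | ⟨h₁, _⟩
    · exact h₁.symm
    · exact absurd ht (hd (h₁ ▸ (hf s hs).1))
  · rintro e ⟨x, hx, t, ht, he⟩
    have htT : t ∈ T := (hu ▸ Set.mem_univ t : t ∈ S ∪ T).resolve_left ht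
    exact ⟨t, htT, ((hf t htT).2.2 e (by rw [he]; exact Sym2.mem_mk_right x t)).symm⟩

end Multigraph

/-- If `|T| = k ≥ 3` and `G[S]` is connected, then `S` can be partitioned into
at most `k - 2` sets, each connectivity-2 linked in `G`. -/
theorem stmt_6 {V E : Type} [Fintype V] [Fintype E] (G : Multigraph V E)
    (S T : Set V) (hG : G.TerminalSetup S T)
    (k : ℕ) (hk : T.ncard = k) (hk3 : 3 ≤ k)
    (hconn : ∀ a ∈ S, ∀ b ∈ S, G.ReachIn S ∅ a b) :
    ∃ (n : ℕ) (f : Fin n → Set V), n ≤ k - 2 ∧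
      (∀ i, (f i).Nonempty ∧ f i ⊆ S ∧ G.Linked 2 (f i)) ∧
      (∀ i j, i ≠ j → Disjoint (f i) (f j)) ∧
      (⋃ i, f i) = S := by
  have hb := hG.ncard_bdry
  obtain ⟨P, hP, hPl, hPd, hPu⟩ :=
    (Multigraph.cutConnected_of_reachIn hconn).exists_linked_partition (by omega)
  refine ⟨P.card, fun i => P.equivFin.symm i, by omega, fun i => ?_, fun i j hij => ?_, ?_⟩
  · have hi := (P.equivFin.symm i).2
    exact ⟨(hPl _ hi).1, hPu ▸ Set.subset_sUnion_of_mem hi, (hPl _ hi).2⟩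
  · exact hPd (P.equivFin.symm i).2 (P.equivFin.symm j).2
      fun h => hij (P.equivFin.symm.injective (Subtype.ext h))
  · rw [← hPu, Set.sUnion_eq_iUnion]
    exact P.equivFin.symm.surjective.iUnion_comp fun Y : P => (Y : Set V)
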